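/- Let G be a finite simple graph that is (P₃ ∪ K₁)-free, has maximum degree Δ(G) ≥ 9 and chromatic number χ(G) > max{ω(G), Δ(G) − 1}, and has the minimum number of vertices among all (P₃ ∪ K₁)-free graphs with these properties. Then χ(G) = Δ(G) > ω(G), and for every vertex u of G one has χ(G − u) = Δ(G) − 1 and deg(u) ≥ Δ(G) − 1. -/

import Mathlib

open SimpleGraph

/-- The graph `H = P₃ ∪ K₁`: a path 0–1–2 together with the isolated vertex 3. -/
def graphH : SimpleGraph (Fin 4) := SimpleGraph.fromEdgeSet {s(0, 1), s(1, 2)}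

/-- The graph `R = K₂ ∪ 2K₁`: the edge 0–1 together with the isolated vertices 2 and 3. -/
def graphR : SimpleGraph (Fin 4) := SimpleGraph.fromEdgeSet {s(0, 1)}

/-- `G` contains no induced subgraph isomorphic to `F`
(graph embeddings are exactly induced-subgraph copies). -/
def IndFree {α : Type*} {V : Type*} (F : SimpleGraph α) (G : SimpleGraph V) : Prop :=
  IsEmpty (F ↪g G)

/-- Maximum degree `Δ(G)` (with classical decidability of adjacency). -/
noncomputable def maxDeg {V : Type*} [Fintype V] (G : SimpleGraph V) : ℕ := by
  classical exact G.maxDegree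

/-- Degree of a vertex (with classical decidability of adjacency). -/
noncomputable def deg {V : Type*} [Fintype V] (G : SimpleGraph V) (v : V) : ℕ := by
  classical exact G.degree v

/-- `c` is a proper colouring of the subgraph of `G` induced on `S`. -/
def IsProperOn {V α : Type*} (G : SimpleGraph V) (c : V → α) (S : Finset V) : Prop :=
  ∀ x ∈ S, ∀ y ∈ S, G.Adj x y → c x ≠ c y

theorem List.exists_first_of_exists_mem {α : Type*} {P : α → Prop} {l : List α}
    (h : ∃ x ∈ l, P x) : ∃ s a t, l = s ++ a :: t ∧ P a ∧ ∀ x ∈ s, ¬ P x := by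
  induction l with
  | nil => simp at h
  | cons b l ih =>
    by_cases hb : P b
    · exact ⟨[], b, l, rfl, hb, by simp⟩
    · have h' : ∃ x ∈ l, P x := by grind
      obtain ⟨s, a, t, rfl, ha, hs⟩ := ih h'
      exact ⟨b :: s, a, t, rfl, ha, by grind⟩

theorem List.exists_last_of_exists_mem {α : Type*} {P : α → Prop} {l : List α}
    (h : ∃ x ∈ l, P x) : ∃ s a t, l = s ++ a :: t ∧ P a ∧ ∀ x ∈ t, ¬ P x := by
  obtain ⟨s, a, t, hl, ha, hs⟩ := List.exists_first_of_exists_mem (P := P) (l := l.reverse)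
    (by simpa using h)
  exact ⟨t.reverse, a, s.reverse, by simpa using congrArg List.reverse hl, ha, by simpa using hs⟩

section Brooks

variable {V : Type*} [DecidableEq V] {G : SimpleGraph V} [DecidableRel G.Adj] {k : ℕ}

/-- A proper partial colouring extends to a vertex which sees fewer than `k` colours. -/
theorem IsProperOn.exists_extend {c : V → Fin k} {S : Finset V} (hc : IsProperOn G c S) {x : V}
    (hx : x ∉ S) (h : ((S.filter (G.Adj x)).image c).card < k) :
    ∃ c' : V → Fin k, (∀ y ∈ S, c' y = c y) ∧ IsProperOn G c' (insert x S) := by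
  obtain ⟨a, ha⟩ : ∃ a, a ∉ (S.filter (G.Adj x)).image c := by
    by_contra! hall
    rw [Finset.eq_univ_iff_forall.2 hall] at h
    simp at h
  have ha' : ∀ y ∈ S, G.Adj x y → c y ≠ a := by simpa using ha
  have hagree : ∀ y ∈ S, Function.update c x a y = c y := fun y hy =>
    Function.update_of_ne (fun e => hx (by rwa [← e])) _ _
  refine ⟨Function.update c x a, hagree, fun y hy z hz hyz => ?_⟩
  rcases Finset.mem_insert.1 hy with rfl | hy' <;> rcases Finset.mem_insert.1 hz with rfl | hz'
  · exact absurd hyz (G.irrefl)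
  · rw [hagree z hz', Function.update_self]
    exact (ha' z hz' hyz).symm
  · rw [hagree y hy', Function.update_self]
    exact ha' y hy' hyz.symm
  · rw [hagree y hy', hagree z hz']
    exact hc y hy' z hz' hyz

variable [Fintype V]

/-- A proper partial colouring extends along a path of uncoloured vertices, except for its
last vertex. -/
theorem IsProperOn.exists_extend_path (hdeg : ∀ v, G.degree v ≤ k) (l : List V) (z : V)
    {c : V → Fin k} {S : Finset V} (hc : IsProperOn G c S) (hch : (l ++ [z]).IsChain G.Adj)
    (hnd : (l ++ [z]).Nodup) (hd : ∀ x ∈ l ++ [z], x ∉ S) :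
    ∃ c' : V → Fin k, (∀ y ∈ S, c' y = c y) ∧ IsProperOn G c' (S ∪ l.toFinset) := by
  induction l generalizing c S with
  | nil => exact ⟨c, fun _ _ => rfl, by simpa using hc⟩
  | cons x l ih =>
    obtain ⟨y, hy, hxy⟩ : ∃ y ∈ l ++ [z], G.Adj x y := by
      cases l with
      | nil => exact ⟨z, by simp, by simpa using hch⟩
      | cons y l => exact ⟨y, by simp, by simp at hch; exact hch.1⟩
    have hlt : ((S.filter (G.Adj x)).image c).card < k := by
      refine (Finset.card_image_le.trans_lt ?_).trans_le (hdeg x)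
      refine Finset.card_lt_card ⟨fun w hw => by simp_all, fun hsub => ?_⟩
      have := hsub ((G.mem_neighborFinset x y).2 hxy)
      exact hd y (by grind) (Finset.mem_filter.1 this).1
    obtain ⟨c₁, h₁, hc₁⟩ := hc.exists_extend (hd x (by simp)) hlt
    obtain ⟨c₂, h₂, hc₂⟩ := ih hc₁ (List.isChain_cons.1 hch).2 (by grind) (by grind)
    refine ⟨c₂, fun y hy => by rw [h₂ y (by simp [hy]), h₁ y hy], ?_⟩
    convert hc₂ using 1
    ext; simp

/-- A proper partial colouring extends along a path of uncoloured vertices whose last vertex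
has two neighbours of the same colour. -/
theorem IsProperOn.exists_extend_path_of_eq (hdeg : ∀ v, G.degree v ≤ k) (l : List V) (z : V)
    {c : V → Fin k} {S : Finset V} (hc : IsProperOn G c S) (hch : (l ++ [z]).IsChain G.Adj)
    (hnd : (l ++ [z]).Nodup) (hd : ∀ x ∈ l ++ [z], x ∉ S) {a b : V} (ha : a ∈ S) (hb : b ∈ S)
    (hab : a ≠ b) (hza : G.Adj z a) (hzb : G.Adj z b) (hcab : c a = c b) :
    ∃ c' : V → Fin k, IsProperOn G c' (S ∪ (l ++ [z]).toFinset) := by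
  obtain ⟨c₁, h₁, hc₁⟩ := hc.exists_extend_path hdeg l z hch hnd hd
  have hlt : (((S ∪ l.toFinset).filter (G.Adj z)).image c₁).card < k := by
    have hsub : ((S ∪ l.toFinset).filter (G.Adj z)).image c₁ ⊆
        ((G.neighborFinset z).erase a).image c₁ := by
      intro i hi
      obtain ⟨y, hy, rfl⟩ := Finset.mem_image.1 hi
      by_cases hya : y = a
      · refine Finset.mem_image.2 ⟨b, by simp [hab.symm, hzb], ?_⟩
        rw [hya, h₁ a ha, h₁ b hb, hcab]
      · exact Finset.mem_image_of_mem _ (by simp_all)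
    have hlt' := Finset.card_erase_lt_of_mem ((G.mem_neighborFinset z a).2 hza)
    exact (((Finset.card_le_card hsub).trans Finset.card_image_le).trans_lt hlt').trans_le (hdeg z)
  obtain ⟨c₂, -, hc₂⟩ := hc₁.exists_extend (x := z) (by grind [List.mem_toFinset]) hlt
  refine ⟨c₂, ?_⟩
  convert hc₂ using 1
  ext; simp

/-- Colouring the vertices of a path that begins `a, v, b` (written backwards), where `a` and `b`
are not adjacent and `v` has a further neighbour on the path. -/
theorem exists_isProperOn_of_path (hdeg : ∀ v, G.degree v ≤ k) {l : List V} {a v b w : V}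
    (hch : (l ++ [b, v, a]).IsChain G.Adj) (hnd : (l ++ [b, v, a]).Nodup) (hab : ¬ G.Adj a b)
    (hw : w ∈ l) (hvw : G.Adj v w) :
    ∃ c : V → Fin k, IsProperOn G c (l ++ [b, v, a]).toFinset := by
  obtain ⟨q, p, rfl⟩ := List.append_of_mem hw
  have hk : 0 < k := lt_of_lt_of_le ((G.degree_pos_iff_exists_adj v).2 ⟨w, hvw⟩) (hdeg v)
  have hbva : [b, v, a].IsChain G.Adj := hch.right_of_append
  simp only [List.isChain_cons_cons] at hbva
  have hc₀ : IsProperOn G (fun _ => (⟨0, hk⟩ : Fin k)) {a, b} := by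
    intro x hx y hy hxy
    simp only [Finset.mem_insert, Finset.mem_singleton] at hx hy
    rcases hx with rfl | rfl <;> rcases hy with rfl | rfl <;>
      first | exact absurd hxy G.irrefl | exact absurd hxy hab | exact absurd hxy.symm hab
  have hwp : (w :: p).IsChain G.Adj := hch.left_of_append.right_of_append
  obtain ⟨c₁, h₁, hc₁⟩ := hc₀.exists_extend_path hdeg p.reverse w
    (by
      rw [← List.reverse_cons, List.isChain_reverse]
      simpa only [G.adj_comm] using hwp)
    (by grind) (by grind)
  have hqw : (q ++ [w]).IsChain G.Adj := by
    have : ((q ++ [w]) ++ p).IsChain G.Adj := by simpa using hch.left_of_append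
    exact this.left_of_append
  obtain ⟨c₂, hc₂⟩ := hc₁.exists_extend_path_of_eq hdeg (q ++ [w]) v (a := a) (b := b)
    (hqw.append (List.isChain_singleton v) (by simpa using hvw.symm))
    (by simp [List.nodup_append] at hnd ⊢; grind) (by grind [List.mem_toFinset]) (by simp) (by simp)
    (by grind) hbva.2.1 hbva.1.symm
    (by rw [h₁ a (by simp), h₁ b (by simp)])
  refine ⟨c₂, ?_⟩
  convert hc₂ using 1
  ext; simp; tauto

/-- Extending a proper partial colouring to a cycle `z :: D`, where `z` sees no coloured vertex
and some vertex of `D` does. -/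
theorem IsProperOn.exists_extend_cycle (hdeg : ∀ v, G.degree v ≤ k) {c : V → Fin k}
    {T : Finset V} (hc : IsProperOn G c T) {z w : V} {p : List V}
    (hch : (z :: (p ++ [w])).IsChain G.Adj) (hnd : (z :: (p ++ [w])).Nodup) (hzw : G.Adj z w)
    (hd : ∀ x ∈ z :: (p ++ [w]), x ∉ T) (hz : ∀ u ∈ T, ¬ G.Adj z u)
    (hout : ∃ x ∈ z :: (p ++ [w]), ∃ u ∈ T, G.Adj x u) :
    ∃ c' : V → Fin k, IsProperOn G c' (T ∪ (z :: (p ++ [w])).toFinset) := by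
  obtain ⟨s, x, B, hsplit, ⟨u, hu, hxu⟩, hs⟩ := List.exists_first_of_exists_mem hout
  obtain ⟨A, y, rfl⟩ : ∃ A y, s = A ++ [y] := by
    rcases List.eq_nil_or_concat s with rfl | ⟨A, y, rfl⟩
    · obtain rfl : z = x := by simpa using congrArg List.head? hsplit
      exact absurd hxu (hz u hu)
    · exact ⟨A, y, by simp⟩
  have hy : ∀ u ∈ T, ¬ G.Adj y u := fun u hu hyu => hs y (by simp) ⟨u, hu, hyu⟩
  have hzhead : (A ++ [y]).head? = some z := by
    have := congrArg List.head? hsplit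
    cases A <;> simp_all
  have hwlast : (x :: B).getLast? = some w := by
    have : (A ++ [y] ++ x :: B).getLast? = some w := by
      rw [← hsplit, ← List.cons_append, List.getLast?_concat]
    rwa [List.getLast?_append_of_ne_nil _ (List.cons_ne_nil x B)] at this
  rw [hsplit] at hch hnd hd ⊢
  have hrev : ((A ++ [y]).reverse ++ (x :: B).reverse).IsChain G.Adj := by
    refine List.IsChain.append ?_ ?_ ?_
    · rw [List.isChain_reverse]
      simpa only [G.adj_comm] using hch.left_of_append
    · rw [List.isChain_reverse]
      simpa only [G.adj_comm] using hch.right_of_append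
    · rw [List.getLast?_reverse, List.head?_reverse, hzhead, hwlast]
      simpa using hzw
  have hyT : y ∉ T := hd y (by simp)
  have hfst : IsProperOn G (Function.update c y (c u)) (insert y T) := by
    have hagree : ∀ t ∈ T, Function.update c y (c u) t = c t := fun t ht =>
      Function.update_of_ne (fun e => hyT (by rwa [← e])) _ _
    intro t ht t' ht' htt'
    rcases Finset.mem_insert.1 ht with rfl | h <;> rcases Finset.mem_insert.1 ht' with rfl | h'
    · exact absurd htt' G.irrefl
    · exact absurd htt' (hy t' h')
    · exact absurd htt'.symm (hy t h)
    · rw [hagree t h, hagree t' h']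
      exact hc t h t' h' htt'
  have hxy : G.Adj x y := by
    have := hch.rel_getLast_head_of_append (by simp) (by simp)
    simpa using this.symm
  have huy : u ≠ y := fun e => hyT (by rwa [← e])
  obtain ⟨c', hc'⟩ := hfst.exists_extend_path_of_eq hdeg (A.reverse ++ B.reverse) x
    (a := u) (b := y)
    (by
      have : (y :: ((A.reverse ++ B.reverse) ++ [x])).IsChain G.Adj := by simpa using hrev
      exact (List.isChain_cons.1 this).2)
    (by simp [List.nodup_append] at hnd ⊢; grind) (by grind) (by simp [hu]) (by simp) huy hxu hxy
    (by simp [Function.update_of_ne huy])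
  refine ⟨c', ?_⟩
  convert hc' using 1
  ext; simp; tauto

/-- A path inside `S` extends backwards to a path inside `S` whose first vertex has all its
neighbours in `S` on the path. -/
theorem exists_maximal_path (S : Finset V) (l₀ : List V) (hne : l₀ ≠ [])
    (hch : l₀.IsChain G.Adj) (hnd : l₀.Nodup) (hS : ∀ x ∈ l₀, x ∈ S) :
    ∃ l : List V, (l ++ l₀).IsChain G.Adj ∧ (l ++ l₀).Nodup ∧ (∀ x ∈ l ++ l₀, x ∈ S) ∧
      ∃ z t, l ++ l₀ = z :: t ∧ ∀ y ∈ S, G.Adj z y → y ∈ t := by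
  induction hn : S.card - l₀.length using Nat.strong_induction_on generalizing l₀ with
  | _ n ih =>
    obtain ⟨z, t, rfl⟩ := List.exists_cons_of_ne_nil hne
    by_cases hmax : ∀ y ∈ S, G.Adj z y → y ∈ t
    · exact ⟨[], hch, hnd, hS, z, t, rfl, hmax⟩
    push Not at hmax
    obtain ⟨y, hy, hzy, hyt⟩ := hmax
    have hnd' : (y :: z :: t).Nodup := by
      have := hzy.ne
      grind
    have hlen : (y :: z :: t).length ≤ S.card := by
      rw [← List.toFinset_card_of_nodup hnd']
      exact Finset.card_le_card fun x hx => by grind [List.mem_toFinset]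
    obtain ⟨l, h⟩ := ih (S.card - (y :: z :: t).length) (by simp at hlen hn ⊢; omega)
      (y :: z :: t) (by simp) (by simpa using ⟨hzy.symm, hch⟩) hnd' (by grind) rfl
    exact ⟨l ++ [y], by simpa using h⟩

/-- **Brooks' theorem** for induced subgraphs. -/
theorem exists_isProperOn_of_degree_le (hk : 3 ≤ k) (hdeg : ∀ v, G.degree v ≤ k)
    (hfree : G.CliqueFree (k + 1)) (S : Finset V) : ∃ c : V → Fin k, IsProperOn G c S := by
  induction S using Finset.strongInduction with
  | _ S ih =>
  rcases S.eq_empty_or_nonempty with rfl | ⟨v, hv⟩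
  · exact ⟨fun _ => ⟨0, by omega⟩, by simp [IsProperOn]⟩
  by_cases hlow : ∃ x ∈ S, (S.filter (G.Adj x)).card < k
  · obtain ⟨x, hx, hxk⟩ := hlow
    obtain ⟨c, hc⟩ := ih (S.erase x) (Finset.erase_ssubset hx)
    have hle : (((S.erase x).filter (G.Adj x)).image c).card ≤ (S.filter (G.Adj x)).card :=
      Finset.card_image_le.trans
        (Finset.card_le_card (Finset.filter_subset_filter _ (Finset.erase_subset x S)))
    obtain ⟨c', -, hc'⟩ := hc.exists_extend (Finset.notMem_erase x S) (hle.trans_lt hxk)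
    exact ⟨c', by rwa [Finset.insert_erase hx] at hc'⟩
  push Not at hlow
  obtain ⟨a, b, ha, hb, hva, hvb, hab, hnab⟩ : ∃ a b, a ∈ S ∧ b ∈ S ∧ G.Adj v a ∧ G.Adj v b ∧
      a ≠ b ∧ ¬ G.Adj a b := by
    by_contra! hall
    obtain ⟨N, hN, hNk⟩ := Finset.exists_subset_card_eq (hlow v hv)
    have hN' : ∀ x ∈ N, x ∈ S ∧ G.Adj v x := fun x hx => by simpa using hN hx
    have hvN : v ∉ N := fun h => G.irrefl (hN' v h).2
    refine hfree (insert v N) ⟨?_, by rw [Finset.card_insert_of_notMem hvN, hNk]⟩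
    intro x hx y hy hxy
    simp only [Finset.coe_insert, Set.mem_insert_iff, Finset.mem_coe] at hx hy
    rcases hx with rfl | hx <;> rcases hy with rfl | hy
    · exact absurd rfl hxy
    · exact (hN' y hy).2
    · exact (hN' x hx).2.symm
    · exact hall x y (hN' x hx).1 (hN' y hy).1 (hN' x hx).2 (hN' y hy).2 hxy
  obtain ⟨l, hch, hnd, hlS, z, t, hzt, hz⟩ := exists_maximal_path (G := G) S [b, v, a] (by simp)
    (by simpa using ⟨hvb.symm, hva⟩) (by have := hva.ne; have := hvb.ne; grind) (by grind)
  by_cases hcover : S = (l ++ [b, v, a]).toFinset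
  · obtain ⟨w, hw, hwab⟩ : ∃ w ∈ S.filter (G.Adj v), w ∉ ({a, b} : Finset V) :=
      Finset.exists_mem_notMem_of_card_lt_card
        (Finset.card_le_two.trans_lt (hk.trans (hlow v hv)))
    obtain ⟨hwS, hvw⟩ := Finset.mem_filter.1 hw
    have hwl : w ∈ l := by
      have := hvw.ne
      rw [hcover] at hwS
      grind [List.mem_toFinset]
    rw [hcover]
    exact exists_isProperOn_of_path hdeg hch hnd hnab hwl hvw
  have hex : ∃ y ∈ t, G.Adj z y := by
    have hzS : z ∈ S := hlS z (by simp [hzt])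
    obtain ⟨y, hy⟩ := Finset.card_pos.1 (lt_of_lt_of_le (by omega) (hlow z hzS))
    obtain ⟨hyS, hzy⟩ := Finset.mem_filter.1 hy
    exact ⟨y, hz y hyS hzy, hzy⟩
  obtain ⟨p, w, q, rfl, hzw, hq⟩ := List.exists_last_of_exists_mem hex
  have hsplit : z :: (p ++ w :: q) = (z :: (p ++ [w])) ++ q := by simp
  rw [hzt, hsplit] at hch hnd hlS hcover
  set C := z :: (p ++ [w]) with hC
  have hCS : C.toFinset ⊆ S := fun x hx => hlS x (by grind [List.mem_toFinset])
  have hTC : S \ C.toFinset ∪ C.toFinset = S := Finset.sdiff_union_of_subset hCS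
  obtain ⟨c, hc⟩ := ih (S \ C.toFinset)
    (Finset.sdiff_ssubset hCS ⟨z, by simp [hC]⟩)
  by_cases hout : ∃ x ∈ C, ∃ u ∈ S \ C.toFinset, G.Adj x u
  · rw [← hTC]
    refine hc.exists_extend_cycle hdeg hch.left_of_append (by grind) hzw
      (fun x hx h => (Finset.mem_sdiff.1 h).2 (List.mem_toFinset.2 hx)) ?_ hout
    intro u hu hzu
    obtain ⟨huS, huC⟩ := Finset.mem_sdiff.1 hu
    have := hz u huS hzu
    grind [List.mem_toFinset]
  · push Not at hout
    have hCne : C.toFinset ≠ S := by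
      rintro h
      refine hcover (Finset.Subset.antisymm ?_ fun x hx => hlS x (by simpa using hx))
      intro x hx
      rw [← h] at hx
      exact List.mem_toFinset.2 (List.mem_append_left _ (List.mem_toFinset.1 hx))
    obtain ⟨d, hd⟩ := ih C.toFinset (hCS.ssubset_of_ne hCne)
    refine ⟨fun x => if x ∈ C then d x else c x, fun x hx y hy hxy => ?_⟩
    by_cases hxC : x ∈ C <;> by_cases hyC : y ∈ C <;> simp only [hxC, hyC, if_true, if_false]
    · exact hd x (by simpa using hxC) y (by simpa using hyC) hxy
    · exact absurd hxy (hout x hxC y (by simp [hy, hyC]))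
    · exact absurd hxy.symm (hout y hyC x (by simp [hx, hxC]))
    · exact hc x (by simp [hx, hxC]) y (by simp [hy, hyC]) hxy

end Brooks

/-- **Brooks' theorem**: a graph with maximum degree at most `k ≥ 3` and no clique on `k + 1`
vertices is `k`-colourable. -/
theorem colorable_of_degree_le_of_cliqueFree {V : Type*} [Fintype V] {G : SimpleGraph V}
    [DecidableRel G.Adj] {k : ℕ} (hk : 3 ≤ k)
    (hdeg : ∀ v, G.degree v ≤ k) (hfree : G.CliqueFree (k + 1)) : G.Colorable k := by
  classical
  obtain ⟨c, hc⟩ := exists_isProperOn_of_degree_le hk hdeg hfree Finset.univ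
  exact ⟨Coloring.mk c fun {x y} hxy => hc x (Finset.mem_univ x) y (Finset.mem_univ y) hxy⟩


/-- A colouring of `G - u` with `k` colours extends to `u` when `u` has fewer than `k`
neighbours. -/
theorem colorable_of_induce_compl_singleton {V : Type*} [Fintype V] {G : SimpleGraph V}
    [DecidableRel G.Adj] {k : ℕ} {u : V} (hu : G.degree u < k)
    (h : (G.induce {u}ᶜ).Colorable k) : G.Colorable k := by
  classical
  obtain ⟨C⟩ := h
  let c : V → Fin k := fun v => if hv : v = u then ⟨0, by omega⟩ else C ⟨v, hv⟩
  have hc : IsProperOn G c (Finset.univ.erase u) := by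
    intro x hx y hy hxy
    have hx' := Finset.ne_of_mem_erase hx
    have hy' := Finset.ne_of_mem_erase hy
    simp only [c, hx', hy', dif_neg, not_false_eq_true]
    exact C.valid (v := ⟨x, hx'⟩) (w := ⟨y, hy'⟩) hxy
  obtain ⟨c', -, hc'⟩ := hc.exists_extend (Finset.notMem_erase u _)
    ((Finset.card_image_le.trans (Finset.card_le_card fun y hy => by simp_all)).trans_lt hu)
  rw [Finset.insert_erase (Finset.mem_univ u)] at hc'
  exact ⟨Coloring.mk c' fun {x y} hxy => hc' x (Finset.mem_univ x) y (Finset.mem_univ y) hxy⟩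

/-- A colouring of `G - u` extends to `G` using one new colour for `u`. -/
theorem colorable_succ_of_induce_compl_singleton {V : Type*} {G : SimpleGraph V} {k : ℕ} {u : V}
    (h : (G.induce {u}ᶜ).Colorable k) : G.Colorable (k + 1) := by
  classical
  obtain ⟨C⟩ := h
  refine ⟨Coloring.mk (fun v => if hv : v = u then Fin.last k else (C ⟨v, hv⟩).castSucc)
    fun {x y} hxy => ?_⟩
  by_cases hx : x = u <;> by_cases hy : y = u
  · exact absurd (hx.trans hy.symm) hxy.ne
  · simp [hx, hy, (Fin.castSucc_lt_last _).ne']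
  · simp [hx, hy, (Fin.castSucc_lt_last _).ne]
  · simpa [hx, hy] using C.valid (v := ⟨x, hx⟩) (w := ⟨y, hy⟩) hxy

theorem cliqueFree_of_cliqueNum_lt {V : Type*} [Finite V] {G : SimpleGraph V} {n : ℕ}
    (h : G.cliqueNum < n) : G.CliqueFree n := fun s hs => by
  have := IsClique.card_le_cliqueNum (tc := hs.isClique)
  have := hs.card_eq
  omega

/-- A minimal `(P₃ ∪ K₁)`-free counterexample `G` to Borodin–Kostochka (i.e. `Δ(G) ≥ 9`,
`χ(G) > max {ω(G), Δ(G) - 1}`, with the fewest vertices among all such graphs) satisfies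
`χ(G) = Δ(G) > ω(G)`, and for every vertex `u`, `χ(G - u) = Δ(G) - 1` and
`deg u ≥ Δ(G) - 1`. -/
theorem minimal_counterexample_P3_union_K1_free {V : Type*} [Fintype V] (G : SimpleGraph V)
    (hfree : IndFree graphH G) (hΔ : 9 ≤ maxDeg G)
    (hχ : ((max G.cliqueNum (maxDeg G - 1) : ℕ) : ℕ∞) < G.chromaticNumber)
    (hmin : ∀ (m : ℕ) (G' : SimpleGraph (Fin m)), IndFree graphH G' → 9 ≤ maxDeg G' →
      ((max G'.cliqueNum (maxDeg G' - 1) : ℕ) : ℕ∞) < G'.chromaticNumber →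
      Fintype.card V ≤ m) :
    G.chromaticNumber = (maxDeg G : ℕ∞) ∧ G.cliqueNum < maxDeg G ∧
      ∀ u : V, (G.induce {u}ᶜ).chromaticNumber = ((maxDeg G - 1 : ℕ) : ℕ∞) ∧
        maxDeg G - 1 ≤ deg G u := by
  classical
  have hdeg : ∀ v, G.degree v ≤ maxDeg G := fun v => G.degree_le_maxDegree v
  have hω : (G.cliqueNum : ℕ∞) < G.chromaticNumber :=
    lt_of_le_of_lt (by exact_mod_cast le_max_left _ _) hχ
  have hnot : ¬ G.Colorable (maxDeg G - 1) := fun h =>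
    (lt_of_le_of_lt (by exact_mod_cast le_max_right _ _) hχ).not_ge h.chromaticNumber_le
  have hcol₁ : G.Colorable (maxDeg G + 1) := by
    refine colorable_of_degree_le_of_cliqueFree (by omega) (fun v => (hdeg v).trans (by omega)) ?_
    intro s hs
    obtain ⟨v, hv⟩ := Finset.card_pos.1 (by rw [hs.card_eq]; omega : 0 < s.card)
    have hle : (s.erase v).card ≤ G.degree v := Finset.card_le_card fun x hx => by
      rw [mem_neighborFinset]
      exact hs.isClique hv (Finset.mem_of_mem_erase hx) (Finset.ne_of_mem_erase hx).symm
    rw [Finset.card_erase_of_mem hv, hs.card_eq] at hle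
    have := hdeg v
    omega
  have hcol : G.Colorable (maxDeg G) := by
    refine colorable_of_degree_le_of_cliqueFree (by omega) hdeg (cliqueFree_of_cliqueNum_lt ?_)
    exact_mod_cast hω.trans_le hcol₁.chromaticNumber_le
  have hωΔ : G.cliqueNum < maxDeg G := by
    exact_mod_cast hω.trans_le hcol.chromaticNumber_le
  have hsub : ∀ u : V, (G.induce {u}ᶜ).Colorable (maxDeg G - 1) := by
    intro u
    let e := (G.induce {u}ᶜ).overFinIso rfl
    obtain ⟨f⟩ : Nonempty ((G.induce {u}ᶜ).overFin rfl ↪g G) :=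
      ⟨(Embedding.induce _).comp e.symm.toEmbedding⟩
    suffices h : ((G.induce {u}ᶜ).overFin rfl).Colorable (maxDeg G - 1) from
      h.of_hom e.toHom
    have hcard : Fintype.card ↥({u}ᶜ : Set V) < Fintype.card V :=
      Fintype.card_subtype_lt (x := u) (by simp)
    generalize (G.induce {u}ᶜ).overFin rfl = G' at f
    have hfree' : G'.CliqueFree (maxDeg G) :=
      (cliqueFree_of_cliqueNum_lt hωΔ).comap ⟨f.toCopy⟩
    have hmax : maxDeg G' ≤ maxDeg G := f.toCopy.maxDegree_mono
    by_contra hnc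
    by_cases h9 : 9 ≤ maxDeg G'
    · refine hcard.not_ge (hmin _ G' ⟨fun g => hfree.false (f.comp g)⟩ h9 ?_)
      by_contra! hle
      refine hnc ((chromaticNumber_le_iff_colorable.1 hle).mono (max_le ?_ (by omega)))
      obtain ⟨s, hs⟩ := G'.exists_isNClique_cliqueNum
      by_contra! hlt
      exact hfree'.mono (by omega) s hs
    · refine hnc (colorable_of_degree_le_of_cliqueFree (by omega) (fun v => ?_) ?_)
      · have : G'.degree v ≤ maxDeg G' := G'.degree_le_maxDegree v
        omega
      · rwa [Nat.sub_add_cancel (by omega)]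
  refine ⟨le_antisymm hcol.chromaticNumber_le ?_, hωΔ, fun u => ⟨?_, ?_⟩⟩
  · refine le_chromaticNumber_iff_colorable.2 fun m hm => ?_
    by_contra! hlt
    exact hnot (hm.mono (by have : m < maxDeg G := by exact_mod_cast hlt
                            omega))
  · refine le_antisymm (hsub u).chromaticNumber_le ?_
    refine le_chromaticNumber_iff_colorable.2 fun m hm => ?_
    by_contra! hlt
    exact hnot ((colorable_succ_of_induce_compl_singleton hm).mono (by exact_mod_cast hlt))
  · by_contra! hlt
    exact hnot (colorable_of_induce_compl_singleton hlt (hsub u))
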